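/- arXiv:1802.07994 — 2 statements merged into one kernel-verified Lean document; each statement's English description precedes it below -/
import Mathlib

section
/- (Comparison principle for the soliton operator with ordered boundary values.) Let D ⊆ ℝ² be a nonempty bounded open set, let λ₁, λ₂ ∈ ℝ with λ₁ ≥ λ₂, and let u₁, u₂ be continuous on the closure of D, with u₁ satisfying the λ₁-soliton graph equation on D and u₂ satisfying the λ₂-soliton graph equation on D. If u₁(x) ≤ u₂(x) for every x ∈ ∂D, then u₁(x) ≤ u₂(x) for every x in the closure of D. -/
open MeasureTheory

noncomputable section

/-- The Euclidean plane. -/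
abbrev E2 := EuclideanSpace ℝ (Fin 2)

/-- `W u x = √(1 + ‖∇u(x)‖²)`. -/
noncomputable def W (u : E2 → ℝ) (x : E2) : ℝ := Real.sqrt (1 + ‖gradient u x‖ ^ 2)

/-- The divergence of a vector field `X : ℝ² → ℝ²`: `div X = ∂₁X₁ + ∂₂X₂`. -/
noncomputable def div2 (X : E2 → E2) (x : E2) : ℝ :=
  ∑ i : Fin 2, fderiv ℝ X x (EuclideanSpace.single i 1) i

/-- `u` satisfies the λ-soliton graph equation on the open set `D`: `u` is C² on `D` and
`div (∇u / W(u)) = 2λ + 1/W(u)` at every point of `D`. -/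
def SatisfiesSolitonEq (lam : ℝ) (D : Set E2) (u : E2 → ℝ) : Prop :=
  ContDiffOn ℝ 2 u D ∧
    ∀ x ∈ D, div2 (fun y => (W u y)⁻¹ • gradient u y) x = 2 * lam + (W u x)⁻¹

end

open Filter Topology in
/-- First and second order necessary conditions at a local maximum on the line. -/
theorem IsLocalMax.deriv_eq_zero_and_deriv_deriv_nonpos {φ ψ : ℝ → ℝ} {a c : ℝ}
    (hmax : IsLocalMax φ a) (hφ : ∀ᶠ s in 𝓝 a, HasDerivAt φ (ψ s) s)
    (hψ : HasDerivAt ψ c a) : ψ a = 0 ∧ c ≤ 0 := by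
  have hderiv : deriv φ =ᶠ[𝓝 a] ψ := hφ.mono fun s hs => hs.deriv
  have h0 : ψ a = 0 := hmax.hasDerivAt_eq_zero hφ.self_of_nhds
  refine ⟨h0, ?_⟩
  by_contra! hc
  have hdd : deriv (deriv φ) a = c := by rw [hderiv.deriv_eq, hψ.deriv]
  have hmin : IsLocalMin φ a := isLocalMin_of_deriv_deriv_pos (hdd ▸ hc)
    (by rw [hderiv.self_of_nhds, h0]) hφ.self_of_nhds.continuousAt
  have hconst : φ =ᶠ[𝓝 a] fun _ => φ a := by
    filter_upwards [hmin, hmax] with s hs hs' using le_antisymm hs' hs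
  have : deriv (deriv φ) a = 0 := by
    rw [hconst.deriv.deriv_eq]
    simp
  linarith

section Gradient

open Topology

variable {E : Type*} [NormedAddCommGroup E] [InnerProductSpace ℝ E] [CompleteSpace E]

theorem ContDiffOn.gradient_of_isOpen {u : E → ℝ} {D : Set E} (hu : ContDiffOn ℝ 2 u D)
    (hD : IsOpen D) : ContDiffOn ℝ 1 (gradient u) D :=
  (InnerProductSpace.toDual ℝ E).symm.toContinuousLinearEquiv.toContinuousLinearMap.contDiff
    |>.comp_contDiffOn (hu.fderiv_of_isOpen (m := 1) hD (by norm_num))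

theorem ContDiffOn.hasDerivAt_line {u : E → ℝ} {D : Set E} (hu : ContDiffOn ℝ 2 u D)
    (hD : IsOpen D) {x : E} (hx : x ∈ D) (v : E) :
    ∀ᶠ s : ℝ in 𝓝 0,
      HasDerivAt (fun s : ℝ => u (x + s • v)) (Inner.inner ℝ (gradient u (x + s • v)) v) s := by
  have hcont : Continuous fun s : ℝ => x + s • v := by fun_prop
  have hmem : ∀ᶠ s : ℝ in 𝓝 0, x + s • v ∈ D :=
    hcont.continuousAt.eventually_mem (hD.mem_nhds (by simpa using hx))
  filter_upwards [hmem] with s hs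
  have hline : HasDerivAt (fun s : ℝ => x + s • v) v s := by
    simpa using ((hasDerivAt_id s).smul_const v).const_add x
  have hd : DifferentiableAt ℝ u (x + s • v) :=
    (hu.contDiffAt (hD.mem_nhds hs)).differentiableAt (by norm_num)
  exact hd.hasGradientAt.hasFDerivAt.comp_hasDerivAt s hline

theorem ContDiffOn.hasDerivAt_inner_gradient_line {u : E → ℝ} {D : Set E}
    (hu : ContDiffOn ℝ 2 u D) (hD : IsOpen D) {x : E} (hx : x ∈ D) (v : E) :
    HasDerivAt (fun s : ℝ => Inner.inner ℝ (gradient u (x + s • v)) v)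
      (Inner.inner ℝ (fderiv ℝ (gradient u) x v) v) 0 := by
  have hline : HasDerivAt (fun s : ℝ => x + s • v) v 0 := by
    simpa using ((hasDerivAt_id (0 : ℝ)).smul_const v).const_add x
  have hd : DifferentiableAt ℝ (gradient u) (x + (0 : ℝ) • v) := by
    rw [zero_smul, add_zero]
    exact ((hu.gradient_of_isOpen hD).contDiffAt (hD.mem_nhds hx)).differentiableAt (by norm_num)
  have h := (hd.hasFDerivAt.comp_hasDerivAt (0 : ℝ) hline).inner ℝ (hasDerivAt_const (0 : ℝ) v)
  simpa using h

end Gradient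

theorem one_le_W (u : E2 → ℝ) (x : E2) : 1 ≤ W u x :=
  Real.one_le_sqrt.2 (by nlinarith [sq_nonneg ‖gradient u x‖])

theorem W_sq (u : E2 → ℝ) (x : E2) : W u x ^ 2 = 1 + gradient u x 0 ^ 2 + gradient u x 1 ^ 2 := by
  rw [W, Real.sq_sqrt (by positivity), EuclideanSpace.norm_sq_eq, Fin.sum_univ_two]
  simp [add_assoc]

/-- The nondivergence form of the mean curvature operator of a graph over the plane. -/
theorem W_cube_mul_div2 {u : E2 → ℝ} {x : E2} (hu : DifferentiableAt ℝ (gradient u) x) :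
    W u x ^ 3 * div2 (fun y => (W u y)⁻¹ • gradient u y) x =
      (1 + gradient u x 1 ^ 2) * fderiv ℝ (gradient u) x (EuclideanSpace.single 0 1) 0
      - gradient u x 0 * gradient u x 1 *
        (fderiv ℝ (gradient u) x (EuclideanSpace.single 0 1) 1
          + fderiv ℝ (gradient u) x (EuclideanSpace.single 1 1) 0)
      + (1 + gradient u x 0 ^ 2) *
        fderiv ℝ (gradient u) x (EuclideanSpace.single 1 1) 1 := by
  have hpos : 0 < W u x := zero_lt_one.trans_le (one_le_W u x)
  have hW := ((hu.hasFDerivAt.norm_sq.const_add 1).sqrt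
    (by positivity : 1 + ‖gradient u x‖ ^ 2 ≠ 0))
  change HasFDerivAt (W u) _ x at hW
  have hX := ((hasDerivAt_inv hpos.ne').comp_hasFDerivAt x hW).smul hu.hasFDerivAt
  have hsq := W_sq u x
  unfold div2
  rw [show (fun y => (W u y)⁻¹ • gradient u y) = (Inv.inv ∘ W u) • gradient u from rfl, hX.fderiv]
  rw [← W.eq_1]
  simp [Fin.sum_univ_two, PiLp.inner_apply, -inner_gradient_left]
  generalize W u x = w at *
  generalize gradient u x 0 = p at *
  generalize gradient u x 1 = q at *
  field_simp
  rw [hsq]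
  ring

open Topology in
/-- First and second order conditions at a local maximum of `u₁ - u₂ + ε exp (α x₀)`. -/
theorem inner_gradient_hessian_of_isLocalMax {D : Set E2} (hD : IsOpen D) {u₁ u₂ : E2 → ℝ}
    (hu₁ : ContDiffOn ℝ 2 u₁ D) (hu₂ : ContDiffOn ℝ 2 u₂ D) {ε α : ℝ} {x : E2} (hx : x ∈ D)
    (hmax : IsLocalMax (fun y : E2 => u₁ y - u₂ y + ε * Real.exp (α * y 0)) x) (v : E2) :
    inner ℝ (gradient u₁ x) v - inner ℝ (gradient u₂ x) v
        + ε * α * Real.exp (α * x 0) * v 0 = 0 ∧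
      inner ℝ (fderiv ℝ (gradient u₁) x v) v - inner ℝ (fderiv ℝ (gradient u₂) x v) v
        + ε * α ^ 2 * Real.exp (α * x 0) * v 0 ^ 2 ≤ 0 := by
  have hlin (s : ℝ) : HasDerivAt (fun s : ℝ => Real.exp (α * (x 0 + s * v 0)))
      (Real.exp (α * (x 0 + s * v 0)) * (α * v 0)) s := by
    have := ((((hasDerivAt_id s).mul_const (v 0)).const_add (x 0)).const_mul α).exp
    simpa using this
  have hcont : Continuous fun s : ℝ => x + s • v := by fun_prop
  have hmax' : IsLocalMax (fun s : ℝ => u₁ (x + s • v) - u₂ (x + s • v)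
      + ε * Real.exp (α * (x 0 + s * v 0))) 0 := by
    have ht : Filter.Tendsto (fun s : ℝ => x + s • v) (𝓝 0) (𝓝 x) := by
      simpa using hcont.tendsto 0
    filter_upwards [ht.eventually hmax] with s hs
    simpa using hs
  have hfst : ∀ᶠ s : ℝ in 𝓝 0, HasDerivAt (fun s : ℝ => u₁ (x + s • v) - u₂ (x + s • v)
      + ε * Real.exp (α * (x 0 + s * v 0)))
      (inner ℝ (gradient u₁ (x + s • v)) v - inner ℝ (gradient u₂ (x + s • v)) v
        + ε * (Real.exp (α * (x 0 + s * v 0)) * (α * v 0))) s := by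
    filter_upwards [hu₁.hasDerivAt_line hD hx v, hu₂.hasDerivAt_line hD hx v] with s hs₁ hs₂
    exact (hs₁.sub hs₂).add ((hlin s).const_mul ε)
  have hsnd := ((hu₁.hasDerivAt_inner_gradient_line hD hx v).sub
    (hu₂.hasDerivAt_inner_gradient_line hD hx v)).add
      (((hlin 0).mul_const (α * v 0)).const_mul ε)
  obtain ⟨h₁, h₂⟩ := hmax'.deriv_eq_zero_and_deriv_deriv_nonpos hfst hsnd
  simp only [zero_smul, add_zero, zero_mul] at h₁ h₂
  constructor <;> nlinarith

/-- The pointwise inequality behind the comparison principle: `(pᵢ, q)` are the gradients,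
`[[aᵢ, bᵢ], [cᵢ, dᵢ]]` the Hessians and `wᵢ` the area elements of two solutions. -/
theorem soliton_comparison_algebra {lam₁ lam₂ M t α p₁ p₂ q w₁ w₂ a₁ s₁ d₁ a₂ b₂ c₂ d₂ : ℝ}
    (hlam : lam₂ ≤ lam₁) (ht : 0 < t) (hα : 0 ≤ α) (hM : 0 ≤ M) (hp : p₁ - p₂ + t = 0)
    (hp₁ : |p₁| ≤ M) (hp₂ : |p₂| ≤ M) (hq : |q| ≤ M)
    (hb₂ : |b₂| ≤ M) (hc₂ : |c₂| ≤ M) (hd₂ : |d₂| ≤ M)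
    (hw₁ : 1 ≤ w₁) (hw₂ : 1 ≤ w₂)
    (hw₁q : w₁ ^ 2 = 1 + p₁ ^ 2 + q ^ 2) (hw₂q : w₂ ^ 2 = 1 + p₂ ^ 2 + q ^ 2)
    (h₁ : (1 + q ^ 2) * a₁ - p₁ * q * s₁ + (1 + p₁ ^ 2) * d₁ = 2 * lam₁ * w₁ ^ 3 + w₁ ^ 2)
    (h₂ : (1 + q ^ 2) * a₂ - p₂ * q * (b₂ + c₂) + (1 + p₂ ^ 2) * d₂
      = 2 * lam₂ * w₂ ^ 3 + w₂ ^ 2)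
    (hxx : a₁ - a₂ + α * t ≤ 0) (hyy : d₁ - d₂ ≤ 0)
    (hperp : q ^ 2 * (a₁ - a₂) - p₁ * q * (s₁ - (b₂ + c₂)) + p₁ ^ 2 * (d₁ - d₂)
      + α * t * q ^ 2 ≤ 0) :
    α ≤ 2 * M ^ 2 + 2 * M * (M + 1) + 12 * |lam₂| * M * (1 + 2 * M ^ 2) := by
  have hsum : |p₁ + p₂| ≤ 2 * M := (abs_add_le _ _).trans (by linarith)
  have hsq {r : ℝ} (hr : |r| ≤ M) : r ^ 2 ≤ M ^ 2 := sq_le_sq' (abs_le.1 hr).1 (abs_le.1 hr).2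
  have hdiff : p₁ ^ 2 - p₂ ^ 2 = -t * (p₁ + p₂) := by
    rw [show p₁ = p₂ - t by linarith]; ring
  have hcubes : |w₁ ^ 3 - w₂ ^ 3| ≤ t * (2 * M) * (3 * (1 + 2 * M ^ 2)) := by
    have hS : w₁ ^ 2 + w₁ * w₂ + w₂ ^ 2 ≤ 3 * (1 + 2 * M ^ 2) := by
      nlinarith [sq_nonneg (w₁ - w₂), hsq hp₁, hsq hp₂, hsq hq]
    have hS0 : 0 ≤ w₁ ^ 2 + w₁ * w₂ + w₂ ^ 2 := by positivity
    have hfactor : (w₁ ^ 3 - w₂ ^ 3) * (w₁ + w₂)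
        = -t * (p₁ + p₂) * (w₁ ^ 2 + w₁ * w₂ + w₂ ^ 2) := by
      rw [← hdiff, show p₁ ^ 2 - p₂ ^ 2 = w₁ ^ 2 - w₂ ^ 2 by linarith]; ring
    calc |w₁ ^ 3 - w₂ ^ 3| ≤ |w₁ ^ 3 - w₂ ^ 3| * (w₁ + w₂) :=
          le_mul_of_one_le_right (abs_nonneg _) (by linarith)
      _ = t * |p₁ + p₂| * (w₁ ^ 2 + w₁ * w₂ + w₂ ^ 2) := by
          have habs := congrArg abs hfactor
          rwa [abs_mul, abs_mul, abs_mul, abs_neg, abs_of_pos ht, abs_of_nonneg hS0,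
            abs_of_pos (by linarith : 0 < w₁ + w₂)] at habs
      _ ≤ _ := by gcongr
  have hlamcubes : -(2 * lam₂ * (w₁ ^ 3 - w₂ ^ 3))
      ≤ t * (12 * |lam₂| * M * (1 + 2 * M ^ 2)) := by
    calc -(2 * lam₂ * (w₁ ^ 3 - w₂ ^ 3)) ≤ |2 * lam₂ * (w₁ ^ 3 - w₂ ^ 3)| := neg_le_abs _
      _ = 2 * |lam₂| * |w₁ ^ 3 - w₂ ^ 3| := by rw [abs_mul, abs_mul, abs_two]
      _ ≤ 2 * |lam₂| * (t * (2 * M) * (3 * (1 + 2 * M ^ 2))) := by gcongr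
      _ = _ := by ring
  have hmixed : t * (q * (b₂ + c₂)) ≤ t * (2 * M ^ 2) := by
    refine mul_le_mul_of_nonneg_left ?_ ht.le
    calc q * (b₂ + c₂) ≤ |q| * |b₂ + c₂| := by rw [← abs_mul]; exact le_abs_self _
      _ ≤ M * (2 * M) := by gcongr; exact (abs_add_le _ _).trans (by linarith)
      _ = _ := by ring
  have hdiag : t * (-(p₁ + p₂) * (d₂ - 1)) ≤ t * (2 * M * (M + 1)) := by
    refine mul_le_mul_of_nonneg_left ?_ ht.le
    calc -(p₁ + p₂) * (d₂ - 1) ≤ |p₁ + p₂| * |d₂ - 1| := by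
          rw [← abs_neg (p₁ + p₂), ← abs_mul]; exact le_abs_self _
      _ ≤ 2 * M * (M + 1) := by
          gcongr
          exact (abs_sub _ _).trans (by rw [abs_one]; linarith)
  have hlamw : lam₂ * w₁ ^ 3 ≤ lam₁ * w₁ ^ 3 := by gcongr
  have hαq : 0 ≤ α * t * q ^ 2 := by positivity
  have hcoef : (p₁ - p₂ + t) * (q * (b₂ + c₂)) = 0 := by rw [hp, zero_mul]
  have hdiffd : (p₁ ^ 2 - p₂ ^ 2) * (d₂ - 1) = -t * (p₁ + p₂) * (d₂ - 1) := by rw [hdiff]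
  refine le_of_mul_le_mul_left ?_ ht
  linarith

/-- Comparison principle for the soliton operator with ordered boundary values. -/
theorem comparison_principle
    (D : Set E2) (hD : D.Nonempty) (hDopen : IsOpen D) (hDbdd : Bornology.IsBounded D)
    (lam₁ lam₂ : ℝ) (hlam : lam₂ ≤ lam₁)
    (u₁ u₂ : E2 → ℝ)
    (hc₁ : ContinuousOn u₁ (closure D)) (hc₂ : ContinuousOn u₂ (closure D))
    (h₁ : SatisfiesSolitonEq lam₁ D u₁) (h₂ : SatisfiesSolitonEq lam₂ D u₂)
    (hbdry : ∀ x ∈ frontier D, u₁ x ≤ u₂ x) :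
    ∀ x ∈ closure D, u₁ x ≤ u₂ x := by
  by_contra! hcon
  obtain ⟨z, hz, hzpos⟩ := hcon
  obtain ⟨hu₁, heq₁⟩ := h₁
  obtain ⟨hu₂, heq₂⟩ := h₂
  have hcl : IsCompact (closure D) := hDbdd.isCompact_closure
  set m : ℝ := (u₁ z - u₂ z) / 2 with hm
  have hmpos : 0 < m := by linarith
  have hcw : ContinuousOn (fun y => u₁ y - u₂ y) (closure D) := hc₁.sub hc₂
  set K : Set E2 := closure D ∩ (fun y => u₁ y - u₂ y) ⁻¹' Set.Ici m with hK
  have hKcompact : IsCompact K :=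
    hcl.of_isClosed_subset (hcw.preimage_isClosed_of_isClosed isClosed_closure isClosed_Ici)
      Set.inter_subset_left
  have hKD : K ⊆ D := by
    rintro y ⟨hy, hym⟩
    by_contra hyD
    have := hbdry y (by rw [hDopen.frontier_eq]; exact ⟨hy, hyD⟩)
    simp only [Set.mem_preimage, Set.mem_Ici] at hym
    linarith
  have hg₁ := hu₁.gradient_of_isOpen hDopen
  have hg₂ := hu₂.gradient_of_isOpen hDopen
  obtain ⟨M₁, hM₁⟩ := hKcompact.exists_bound_of_continuousOn (hg₁.continuousOn.mono hKD)
  obtain ⟨M₂, hM₂⟩ := hKcompact.exists_bound_of_continuousOn (hg₂.continuousOn.mono hKD)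
  obtain ⟨M₃, hM₃⟩ := hKcompact.exists_bound_of_continuousOn
    ((hg₂.continuousOn_fderiv_of_isOpen hDopen le_rfl).mono hKD)
  set M : ℝ := max 0 (max M₁ (max M₂ M₃)) with hM
  have hM0 : 0 ≤ M := le_max_left _ _
  have hM₁M : M₁ ≤ M := by simp [hM]
  have hM₂M : M₂ ≤ M := by simp [hM]
  have hM₃M : M₃ ≤ M := by simp [hM]
  set C : ℝ := 2 * M ^ 2 + 2 * M * (M + 1) + 12 * |lam₂| * M * (1 + 2 * M ^ 2) with hC
  have hC0 : 0 ≤ C := by positivity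
  set α : ℝ := C + 1 with hα
  have hcexp : Continuous fun y : E2 => Real.exp (α * y 0) := by fun_prop
  obtain ⟨B, hB⟩ := hcl.exists_bound_of_continuousOn hcexp.continuousOn
  have hexpB : ∀ y ∈ closure D, Real.exp (α * y 0) ≤ B := fun y hy =>
    (le_abs_self _).trans (hB y hy)
  have hBpos : 0 < B := (Real.exp_pos _).trans_le (hexpB z hz)
  set ε : ℝ := m / B with hε
  have hεpos : 0 < ε := div_pos hmpos hBpos
  have hperturbed :
      ContinuousOn (fun y : E2 => u₁ y - u₂ y + ε * Real.exp (α * y 0)) (closure D) :=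
    hcw.add (continuousOn_const.mul hcexp.continuousOn)
  obtain ⟨x, hx, hxmax⟩ := hcl.exists_isMaxOn ⟨z, hz⟩ hperturbed
  have hxK : x ∈ K := by
    refine ⟨hx, ?_⟩
    have h := hxmax hz
    simp only [Set.mem_ofPred_eq] at h
    have hbound : ε * Real.exp (α * x 0) ≤ m := by
      calc ε * Real.exp (α * x 0) ≤ ε * B := by gcongr; exact hexpB x hx
        _ = m := div_mul_cancel₀ _ hBpos.ne'
    have : 0 < ε * Real.exp (α * z 0) := by positivity
    simp only [Set.mem_preimage, Set.mem_Ici]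
    linarith
  have hxD : x ∈ D := hKD hxK
  have hlocmax : IsLocalMax (fun y : E2 => u₁ y - u₂ y + ε * Real.exp (α * y 0)) x :=
    hxmax.isLocalMax (Filter.mem_of_superset (hDopen.mem_nhds hxD) subset_closure)
  have htest := inner_gradient_hessian_of_isLocalMax hDopen hu₁ hu₂ hxD hlocmax
  have hd₁ : DifferentiableAt ℝ (gradient u₁) x :=
    (hg₁.contDiffAt (hDopen.mem_nhds hxD)).differentiableAt (by norm_num)
  have hd₂ : DifferentiableAt ℝ (gradient u₂) x :=
    (hg₂.contDiffAt (hDopen.mem_nhds hxD)).differentiableAt (by norm_num)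
  have hE₁ := W_cube_mul_div2 hd₁
  have hE₂ := W_cube_mul_div2 hd₂
  have hW₁ := one_le_W u₁ x
  have hW₂ := one_le_W u₂ x
  rw [heq₁ x hxD, mul_add, show W u₁ x ^ 3 * (W u₁ x)⁻¹ = W u₁ x ^ 2 by field_simp] at hE₁
  rw [heq₂ x hxD, mul_add, show W u₂ x ^ 3 * (W u₂ x)⁻¹ = W u₂ x ^ 2 by field_simp] at hE₂
  have hcoord (y : E2) (i : Fin 2) : |y i| ≤ ‖y‖ := PiLp.norm_apply_le y i
  have hhess (i j : Fin 2) :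
      |fderiv ℝ (gradient u₂) x (EuclideanSpace.single i 1) j| ≤ M := by
    refine (hcoord _ j).trans (((fderiv ℝ (gradient u₂) x).le_opNorm _).trans ?_)
    simpa using (hM₃ x hxK).trans hM₃M
  have hfst := htest (EuclideanSpace.single 0 1)
  have hsnd := htest (EuclideanSpace.single 1 1)
  have hperp := htest (-(gradient u₁ x 1) • EuclideanSpace.single 0 1
    + gradient u₁ x 0 • EuclideanSpace.single 1 1)
  simp only [map_add, map_smul, PiLp.inner_apply, Fin.sum_univ_two] at hfst hsnd hperp
  simp at hfst hsnd hperp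
  have hgrad : gradient u₂ x 1 = gradient u₁ x 1 := by linarith [hsnd.1]
  have hsq₂ := W_sq u₂ x
  rw [hgrad] at hE₂ hsq₂
  have hαC := soliton_comparison_algebra hlam (t := ε * α * Real.exp (α * x 0)) (M := M) (α := α)
    (a₁ := fderiv ℝ (gradient u₁) x (EuclideanSpace.single 0 1) 0)
    (s₁ := fderiv ℝ (gradient u₁) x (EuclideanSpace.single 0 1) 1
      + fderiv ℝ (gradient u₁) x (EuclideanSpace.single 1 1) 0)
    (d₁ := fderiv ℝ (gradient u₁) x (EuclideanSpace.single 1 1) 1)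
    (a₂ := fderiv ℝ (gradient u₂) x (EuclideanSpace.single 0 1) 0)
    (by positivity) (by positivity) hM0 hfst.1
    ((hcoord _ 0).trans ((hM₁ x hxK).trans hM₁M)) ((hcoord _ 0).trans ((hM₂ x hxK).trans hM₂M))
    ((hcoord _ 1).trans ((hM₁ x hxK).trans hM₁M)) (hhess 0 1) (hhess 1 0) (hhess 1 1)
    hW₁ hW₂ (W_sq u₁ x) hsq₂ (by linarith) (by linarith)
    (by linarith [hfst.2]) (by linarith [hsnd.2]) (by linarith [hperp.2])
  linarith
end

section
/- (Symmetry inheritance; graph form of Theorem 5.) Let D ⊆ ℝ² be a nonempty bounded open set, let λ ∈ ℝ, and let u be continuous on the closure of D, equal to 0 at every point of ∂D, and satisfy the λ-soliton graph equation on D. Let T : ℝ² → ℝ² be a Euclidean isometry with T(D) = D. Then u ∘ T = u on the closure of D: the graph of u inherits every symmetry of its boundary domain. -/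
open MeasureTheory

open InnerProductSpace

/-- The rotation of a plane vector by a right angle. -/
def rot (p : E2) : E2 := !₂[p 1, -p 0]

lemma norm_rot (p : E2) : ‖rot p‖ = ‖p‖ := by
  simp [EuclideanSpace.norm_eq, rot, Fin.sum_univ_two, add_comm]

lemma rot_sub (p q : E2) : rot p - rot q = rot (p - q) := by
  ext i
  fin_cases i <;> simp [rot]
  ring

lemma contDiffOn_gradient {D : Set E2} {u : E2 → ℝ} (hD : IsOpen D)
    (hu : ContDiffOn ℝ 2 u D) : ContDiffOn ℝ 1 (gradient u) D :=
  (toDual ℝ E2).symm.contDiff.comp_contDiffOn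
    (hu.fderiv_of_isOpen hD (by norm_num [one_add_one_eq_two]))

/-- Expansion of the divergence of `G / √(1 + ‖G‖²)` as a trace against the matrix
`I + (rot G) (rot G)ᵀ`. -/
lemma div2_normalized_mul {G : E2 → E2} {x : E2} (hG : DifferentiableAt ℝ G x) :
    div2 (fun y => (√(1 + ‖G y‖ ^ 2))⁻¹ • G y) x * √(1 + ‖G x‖ ^ 2) ^ 3 =
      ⟪fderiv ℝ G x (EuclideanSpace.single 0 1), EuclideanSpace.single 0 1⟫_ℝ +
      ⟪fderiv ℝ G x (EuclideanSpace.single 1 1), EuclideanSpace.single 1 1⟫_ℝ +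
      ⟪fderiv ℝ G x (rot (G x)), rot (G x)⟫_ℝ := by
  have hpos : 0 < 1 + ‖G x‖ ^ 2 := by positivity
  have hs : 0 < √(1 + ‖G x‖ ^ 2) := Real.sqrt_pos.2 hpos
  have hsq : √(1 + ‖G x‖ ^ 2) ^ 2 = 1 + ‖G x‖ ^ 2 := Real.sq_sqrt hpos.le
  have hnorm : ‖G x‖ ^ 2 = G x 0 ^ 2 + G x 1 ^ 2 := by
    simp [EuclideanSpace.norm_sq_eq, Fin.sum_univ_two]
  have hrot : rot (G x) =
      G x 1 • EuclideanSpace.single 0 1 - G x 0 • EuclideanSpace.single 1 1 := by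
    ext i
    fin_cases i <;> simp [rot]
  have hder := ((hasDerivAt_inv hs.ne').comp_hasFDerivAt x
    ((hG.hasFDerivAt.norm_sq.const_add 1).sqrt hpos.ne')).smul hG.hasFDerivAt |>.fderiv
  unfold div2
  rw [show (fun y => (√(1 + ‖G y‖ ^ 2))⁻¹ • G y) =
    (Inv.inv ∘ fun y => √(1 + ‖G y‖ ^ 2)) • G from rfl, hder, hrot]
  generalize fderiv ℝ G x = H
  simp only [map_sub, map_smul]
  simp [Fin.sum_univ_two, PiLp.inner_apply]
  rw [hnorm] at hs hsq ⊢
  set s := √(1 + (G x 0 ^ 2 + G x 1 ^ 2))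
  field_simp
  rw [hsq]
  ring

/-- Second-order necessary condition at a local maximum. -/
lemma IsLocalMax.inner_apply_self_nonpos {F : Type*} [NormedAddCommGroup F]
    [InnerProductSpace ℝ F] [CompleteSpace F] {f : F → ℝ} {G : F → F} {H : F →L[ℝ] F} {x : F}
    (hmax : IsLocalMax f x) (hf : ∀ᶠ y in nhds x, HasGradientAt f (G y) y)
    (hG : HasFDerivAt G H x) (d : F) : ⟪H d, d⟫_ℝ ≤ 0 := by
  by_contra! hpos
  set c : ℝ → F := fun s => x + s • d
  have hc (s : ℝ) : HasDerivAt c d s := by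
    simpa [c] using ((hasDerivAt_id s).smul_const d).const_add x
  have hc0 : c 0 = x := by simp [c]
  have htend : Filter.Tendsto c (nhds 0) (nhds x) := by
    simpa [ContinuousAt, hc0] using (hc 0).continuousAt
  have hd1 : ∀ᶠ s in nhds (0 : ℝ), HasDerivAt (f ∘ c) ⟪G (c s), d⟫_ℝ s := by
    filter_upwards [htend.eventually hf] with s hs
    simpa using hs.hasFDerivAt.comp_hasDerivAt s (hc s)
  have hd1' : deriv (f ∘ c) =ᶠ[nhds 0] fun s => ⟪G (c s), d⟫_ℝ :=
    hd1.mono fun s hs => hs.deriv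
  have hGx : G x = 0 := by
    simpa using hmax.hasFDerivAt_eq_zero hf.self_of_nhds.hasFDerivAt
  have hd2 : HasDerivAt (fun s => ⟪G (c s), d⟫_ℝ) ⟪H d, d⟫_ℝ 0 := by
    have h1 : HasDerivAt (G ∘ c) (H d) 0 :=
      HasFDerivAt.comp_hasDerivAt 0 (by rwa [hc0]) (hc 0)
    simpa using h1.inner ℝ (hasDerivAt_const 0 d)
  have hmin : IsLocalMin (f ∘ c) 0 := by
    refine isLocalMin_of_deriv_deriv_pos ?_ ?_ hd1.self_of_nhds.continuousAt
    · rw [hd1'.deriv_eq, hd2.deriv]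
      exact hpos
    · rw [hd1.self_of_nhds.deriv, hc0, hGx, inner_zero_left]
  have hconst : f ∘ c =ᶠ[nhds 0] fun _ => f x := by
    filter_upwards [hmin, htend.eventually hmax] with s h1 h2
    simp only [Function.comp_apply, hc0] at h1
    exact le_antisymm h2 h1
  have hzero : (fun s => ⟪G (c s), d⟫_ℝ) =ᶠ[nhds 0] fun _ => 0 := by
    refine hd1'.symm.trans (hconst.deriv.trans ?_)
    simp
  have := hzero.deriv_eq
  rw [hd2.deriv, deriv_const] at this
  exact hpos.ne' this

/-- The non-divergence form of the soliton equation. -/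
lemma SatisfiesSolitonEq.nondiv {lam : ℝ} {D : Set E2} {u : E2 → ℝ} (hD : IsOpen D)
    (hu : SatisfiesSolitonEq lam D u) {x : E2} (hx : x ∈ D) :
    ⟪fderiv ℝ (gradient u) x (EuclideanSpace.single 0 1), EuclideanSpace.single 0 1⟫_ℝ +
      ⟪fderiv ℝ (gradient u) x (EuclideanSpace.single 1 1), EuclideanSpace.single 1 1⟫_ℝ +
      ⟪fderiv ℝ (gradient u) x (rot (gradient u x)), rot (gradient u x)⟫_ℝ =
      2 * lam * W u x ^ 3 + W u x ^ 2 := by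
  have hG : DifferentiableAt ℝ (gradient u) x :=
    ((contDiffOn_gradient hD hu.1).differentiableOn one_ne_zero).differentiableAt
      (hD.mem_nhds hx)
  rw [← div2_normalized_mul hG]
  have hW : 0 < W u x := Real.sqrt_pos.2 (by positivity)
  have := hu.2 x hx
  change div2 (fun y => (W u y)⁻¹ • gradient u y) x * W u x ^ 3 = _
  rw [this]
  field_simp

/-- The part of the soliton equation depending on the gradient is Lipschitz on bounded sets. -/
lemma soliton_coeff_lipschitz {R B lam : ℝ} {p q : E2} (H : E2 →L[ℝ] E2) (hp : ‖p‖ ≤ R)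
    (hq : ‖q‖ ≤ R) (hH : ‖H‖ ≤ B) :
    (⟪H (rot p), rot p⟫_ℝ - 2 * lam * √(1 + ‖p‖ ^ 2) ^ 3 - √(1 + ‖p‖ ^ 2) ^ 2) -
      (⟪H (rot q), rot q⟫_ℝ - 2 * lam * √(1 + ‖q‖ ^ 2) ^ 3 - √(1 + ‖q‖ ^ 2) ^ 2) ≤
      (2 * B * R + 6 * |lam| * R * (1 + R) ^ 2 + 2 * R) * ‖p - q‖ := by
  have hR : 0 ≤ R := (norm_nonneg p).trans hp
  have hB : 0 ≤ B := (norm_nonneg H).trans hH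
  have ht := norm_nonneg (p - q)
  have hquad : ⟪H (rot p), rot p⟫_ℝ - ⟪H (rot q), rot q⟫_ℝ ≤ 2 * B * R * ‖p - q‖ := by
    have hsplit : ⟪H (rot p), rot p⟫_ℝ - ⟪H (rot q), rot q⟫_ℝ =
        ⟪H (rot (p - q)), rot p⟫_ℝ + ⟪H (rot q), rot (p - q)⟫_ℝ := by
      simp only [← rot_sub, map_sub, inner_sub_left, inner_sub_right]
      ring
    have hbound (a b c : E2) (ha : ‖a‖ ≤ ‖b‖) : ⟪H a, c⟫_ℝ ≤ B * ‖b‖ * ‖c‖ := by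
      refine (real_inner_le_norm _ _).trans ?_
      gcongr
      exact (H.le_opNorm a).trans (by gcongr)
    have h1 := hbound _ _ (rot p) (norm_rot (p - q)).le
    have h2 := hbound _ _ (rot (p - q)) (norm_rot q).le
    rw [norm_rot] at h1 h2
    have h3 : B * ‖p - q‖ * ‖p‖ ≤ B * ‖p - q‖ * R := by gcongr
    have h4 : B * ‖q‖ * ‖p - q‖ ≤ B * R * ‖p - q‖ := by gcongr
    rw [hsplit]
    linarith
  have hsqdiff : |‖p‖ ^ 2 - ‖q‖ ^ 2| ≤ 2 * R * ‖p - q‖ := by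
    rw [sq_sub_sq, abs_mul, abs_of_nonneg (by positivity)]
    gcongr
    · linarith
    · exact abs_norm_sub_norm_le p q
  have hone (a : E2) : 1 ≤ √(1 + ‖a‖ ^ 2) :=
    Real.one_le_sqrt.2 (by nlinarith [sq_nonneg ‖a‖])
  have hle (a : E2) (ha : ‖a‖ ≤ R) : √(1 + ‖a‖ ^ 2) ≤ 1 + R :=
    Real.sqrt_le_iff.2 ⟨by positivity, by nlinarith [norm_nonneg a]⟩
  have hsqp : √(1 + ‖p‖ ^ 2) ^ 2 = 1 + ‖p‖ ^ 2 := Real.sq_sqrt (by positivity)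
  have hsqq : √(1 + ‖q‖ ^ 2) ^ 2 = 1 + ‖q‖ ^ 2 := Real.sq_sqrt (by positivity)
  have hp1 := hone p
  have hq1 := hone q
  have hp2 := hle p hp
  have hq2 := hle q hq
  generalize √(1 + ‖p‖ ^ 2) = a at *
  generalize √(1 + ‖q‖ ^ 2) = b at *
  have hab : |a - b| ≤ R * ‖p - q‖ := by
    have h1 : (a - b) * (a + b) = ‖p‖ ^ 2 - ‖q‖ ^ 2 := by linarith
    have h2 : |a - b| * (a + b) ≤ 2 * R * ‖p - q‖ := by
      rw [← abs_of_nonneg (by linarith : 0 ≤ a + b), ← abs_mul, h1]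
      exact hsqdiff
    nlinarith [abs_nonneg (a - b)]
  have hcube : |a ^ 3 - b ^ 3| ≤ R * ‖p - q‖ * (3 * (1 + R) ^ 2) := by
    rw [show a ^ 3 - b ^ 3 = (a - b) * (a ^ 2 + a * b + b ^ 2) by ring, abs_mul,
      abs_of_nonneg (by positivity : 0 ≤ a ^ 2 + a * b + b ^ 2)]
    gcongr
    nlinarith
  have hlam : -(2 * lam * (a ^ 3 - b ^ 3)) ≤
      2 * |lam| * (R * ‖p - q‖ * (3 * (1 + R) ^ 2)) := by
    refine (neg_le_abs _).trans ?_
    rw [abs_mul, abs_mul, abs_two]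
    gcongr
  have := (abs_le.1 hsqdiff).1
  linarith

/-- Comparison principle for the soliton graph equation. -/
lemma SatisfiesSolitonEq.le_of_le_frontier {lam : ℝ} {D : Set E2} {u v : E2 → ℝ} (hD : IsOpen D)
    (hDbdd : Bornology.IsBounded D) (hu : SatisfiesSolitonEq lam D u)
    (hv : SatisfiesSolitonEq lam D v) (huc : ContinuousOn u (closure D))
    (hvc : ContinuousOn v (closure D)) (hle : ∀ x ∈ frontier D, u x ≤ v x) {z : E2}
    (hz : z ∈ closure D) : u z ≤ v z := by
  by_contra! hlt
  have hcpt : IsCompact (closure D) := hDbdd.isCompact_closure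
  obtain ⟨m, hm0, hm⟩ : ∃ m > 0, m = (u z - v z) / 2 := ⟨_, by linarith, rfl⟩
  have hGu := contDiffOn_gradient hD hu.1
  have hGv := contDiffOn_gradient hD hv.1
  set K := closure D ∩ {x | m ≤ u x - v x}
  have hKclosed : IsClosed K :=
    (huc.sub hvc).preimage_isClosed_of_isClosed isClosed_closure isClosed_Ici
  have hK : IsCompact K := hcpt.of_isClosed_subset hKclosed Set.inter_subset_left
  have hKD : K ⊆ D := by
    rintro x ⟨hx, hxm⟩
    by_contra hxD
    have := hle x (by rw [hD.frontier_eq]; exact ⟨hx, hxD⟩)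
    simp only [Set.mem_ofPred_eq] at hxm
    linarith
  obtain ⟨Ru, hRu⟩ := hK.exists_bound_of_continuousOn (hGu.continuousOn.mono hKD)
  obtain ⟨Rv, hRv⟩ := hK.exists_bound_of_continuousOn (hGv.continuousOn.mono hKD)
  obtain ⟨B, hB⟩ := hK.exists_bound_of_continuousOn
    ((hGv.continuousOn_fderiv_of_isOpen hD le_rfl).mono hKD)
  set R := max Ru Rv
  set L := 2 * B * R + 6 * |lam| * R * (1 + R) ^ 2 + 2 * R
  obtain ⟨a, ha0, haL⟩ : ∃ a > 0, L < a :=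
    ⟨max L 0 + 1, by positivity, by linarith [le_max_left L 0]⟩
  obtain ⟨C, hC⟩ := hcpt.exists_bound_of_continuousOn
    (f := fun x : E2 => Real.exp (a * x 0)) (by fun_prop)
  have hCpos : 0 < C := (norm_pos_iff.2 (Real.exp_ne_zero _)).trans_le (hC z hz)
  obtain ⟨e, he0, heC⟩ : ∃ e > 0, e * C ≤ m := ⟨m / C, by positivity, by field_simp; rfl⟩
  set f : E2 → ℝ := fun x => u x - v x + e * Real.exp (a * x 0)
  obtain ⟨x, hx, hmax⟩ := hcpt.exists_isMaxOn ⟨z, hz⟩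
    (f := f) ((huc.sub hvc).add (by fun_prop))
  have hxK : x ∈ K := by
    refine ⟨hx, ?_⟩
    have h1 : f z ≤ f x := hmax hz
    have h2 := (le_abs_self _).trans (hC x hx)
    have h3 := Real.exp_pos (a * z 0)
    have h4 := mul_le_mul_of_nonneg_left h2 he0.le
    have h5 := mul_pos he0 h3
    simp only [Set.mem_ofPred_eq, f] at *
    linarith
  have hxD := hKD hxK
  have hloc : IsLocalMax f x :=
    (hmax.on_subset subset_closure).isLocalMax (hD.mem_nhds hxD)
  have hexp (y : E2) : HasFDerivAt (fun y : E2 => Real.exp (a * y 0))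
      ((Real.exp (a * y 0) * a) • (EuclideanSpace.proj 0 : E2 →L[ℝ] ℝ)) y := by
    simpa [smul_smul] using
      (((EuclideanSpace.proj 0 : E2 →L[ℝ] ℝ).hasFDerivAt (x := y)).const_mul a).exp
  set G : E2 → E2 := fun y => gradient u y - gradient v y +
    (e * a * Real.exp (a * y 0)) • EuclideanSpace.single 0 1
  have hgrad : ∀ᶠ y in nhds x, HasGradientAt f (G y) y := by
    filter_upwards [hD.mem_nhds hxD] with y hy
    have h1 := (hu.1.differentiableOn two_ne_zero).differentiableAt (hD.mem_nhds hy)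
    have h2 := (hv.1.differentiableOn two_ne_zero).differentiableAt (hD.mem_nhds hy)
    rw [hasGradientAt_iff_hasFDerivAt]
    refine ((h1.hasGradientAt.hasFDerivAt.sub h2.hasGradientAt.hasFDerivAt).add
      ((hexp y).const_mul e)).congr_fderiv ?_
    ext d
    simp [G, EuclideanSpace.inner_single_left]
    ring
  have hGder : HasFDerivAt G (fderiv ℝ (gradient u) x - fderiv ℝ (gradient v) x +
      ((e * a * (Real.exp (a * x 0) * a)) • (EuclideanSpace.proj 0 : E2 →L[ℝ] ℝ)).smulRight
        (EuclideanSpace.single 0 1)) x := by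
    have h1 := (hGu.differentiableOn one_ne_zero).differentiableAt (hD.mem_nhds hxD)
    have h2 := (hGv.differentiableOn one_ne_zero).differentiableAt (hD.mem_nhds hxD)
    refine ((h1.hasFDerivAt.sub h2.hasFDerivAt).add
      (((hexp x).const_mul (e * a)).smul_const _)).congr_fderiv ?_
    ext d
    simp [mul_assoc]
  obtain ⟨t, ht0, ht⟩ : ∃ t > 0, t = e * a * Real.exp (a * x 0) := ⟨_, by positivity, rfl⟩
  have hdiff : ‖gradient u x - gradient v x‖ = t := by
    have hGx : G x = 0 := by
      simpa using hloc.hasFDerivAt_eq_zero hgrad.self_of_nhds.hasFDerivAt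
    rw [eq_neg_of_add_eq_zero_left hGx, ← ht]
    simp [norm_smul, abs_of_pos ht0]
  have hsecond (d : E2) : ⟪fderiv ℝ (gradient u) x d, d⟫_ℝ -
      ⟪fderiv ℝ (gradient v) x d, d⟫_ℝ + t * a * d 0 ^ 2 ≤ 0 := by
    have := hloc.inner_apply_self_nonpos hgrad hGder d
    simp [inner_add_left, inner_sub_left, inner_smul_left, EuclideanSpace.inner_single_left] at this
    rw [ht]
    linarith
  have h0 := hsecond (EuclideanSpace.single 0 1)
  have h1 := hsecond (EuclideanSpace.single 1 1)
  have h2 := hsecond (rot (gradient u x))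
  have hEu := hu.nondiv hD hxD
  have hEv := hv.nondiv hD hxD
  have hlip := soliton_coeff_lipschitz (lam := lam) (fderiv ℝ (gradient v) x)
    ((hRu x hxK).trans (le_max_left Ru Rv)) ((hRv x hxK).trans (le_max_right Ru Rv)) (hB x hxK)
  have h3 : 0 ≤ t * a * rot (gradient u x) 0 ^ 2 := by positivity
  have h4 : L * t < a * t := by gcongr
  rw [hdiff] at hlip
  simp only [W] at hEu hEv
  simp at h0 h1
  linarith

lemma gradient_comp_isometry (u : E2 → ℝ) (A : E2 ≃ₗᵢ[ℝ] E2) (b x : E2) :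
    gradient (fun y => u (A y + b)) x = A.symm (gradient u (A x + b)) := by
  refine ext_inner_right ℝ fun d => ?_
  have hfd : fderiv ℝ (fun y => u (A y + b)) x =
      (fderiv ℝ u (A x + b)).comp (A : E2 →L[ℝ] E2) := by
    rw [← fderiv_comp_add_right b]
    exact A.toContinuousLinearEquiv.comp_right_fderiv (f := fun y => u (y + b))
  rw [inner_gradient_left, hfd, ← A.inner_map_map, A.apply_symm_apply, inner_gradient_left]
  rfl

lemma div2_eq_trace (X : E2 → E2) (x : E2) :
    div2 X x = LinearMap.trace ℝ E2 (fderiv ℝ X x : E2 →ₗ[ℝ] E2) := by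
  rw [LinearMap.trace_eq_sum_inner _ (EuclideanSpace.basisFun (Fin 2) ℝ)]
  simp [div2, Fin.sum_univ_two, PiLp.inner_apply]

/-- The divergence is invariant under Euclidean isometries. -/
lemma div2_comp_isometry (X : E2 → E2) (A : E2 ≃ₗᵢ[ℝ] E2) (b x : E2) :
    div2 (fun y => A.symm (X (A y + b))) x = div2 X (A x + b) := by
  have hfd : fderiv ℝ (fun y => A.symm (X (A y + b))) x =
      ((A.symm : E2 →L[ℝ] E2).comp (fderiv ℝ X (A x + b))).comp (A : E2 →L[ℝ] E2) := by
    rw [← fderiv_comp_add_right b]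
    refine (A.symm.toContinuousLinearEquiv.comp_fderiv (f := fun y => X (A y + b))).trans ?_
    rw [ContinuousLinearMap.comp_assoc]
    congr 1
    exact A.toContinuousLinearEquiv.comp_right_fderiv (f := fun y => X (y + b))
  rw [div2_eq_trace, div2_eq_trace, hfd,
    ← LinearMap.trace_conj' (fderiv ℝ X (A x + b) : E2 →ₗ[ℝ] E2) A.symm.toLinearEquiv]
  congr 1

lemma SatisfiesSolitonEq.comp_isometry {lam : ℝ} {D : Set E2} {u : E2 → ℝ}
    (hu : SatisfiesSolitonEq lam D u) (A : E2 ≃ₗᵢ[ℝ] E2) (b : E2)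
    (hmaps : ∀ x ∈ D, A x + b ∈ D) :
    SatisfiesSolitonEq lam D fun y => u (A y + b) := by
  have hW (x : E2) : W (fun y => u (A y + b)) x = W u (A x + b) := by
    rw [W, W, gradient_comp_isometry, A.symm.norm_map]
  refine ⟨hu.1.comp (A.contDiff.add contDiff_const).contDiffOn hmaps, fun x hx => ?_⟩
  have hX : (fun y => (W (fun y => u (A y + b)) y)⁻¹ • gradient (fun y => u (A y + b)) y) =
      fun y => A.symm ((fun y => (W u y)⁻¹ • gradient u y) (A y + b)) := by
    ext1 y
    rw [hW, gradient_comp_isometry, map_smul]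
  rw [hX, div2_comp_isometry (fun y => (W u y)⁻¹ • gradient u y), hW]
  exact hu.2 _ (hmaps x hx)

/-- Symmetry inheritance; graph form of Theorem 5: a λ-translating graph with zero
boundary values inherits every Euclidean symmetry of its boundary domain. -/
theorem symmetry_inheritance
    (D : Set E2) (hD : D.Nonempty) (hDopen : IsOpen D) (hDbdd : Bornology.IsBounded D)
    (lam : ℝ) (u : E2 → ℝ)
    (hcont : ContinuousOn u (closure D))
    (hzero : ∀ x ∈ frontier D, u x = 0)
    (hsol : SatisfiesSolitonEq lam D u)
    (T : E2 → E2) (A : E2 ≃ₗᵢ[ℝ] E2) (b : E2)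
    (hT : ∀ x : E2, T x = A x + b)
    (hTD : T '' D = D) :
    ∀ x ∈ closure D, u (T x) = u x := by
  obtain rfl : T = fun x => A x + b := funext hT
  have himage (s : Set E2) : (fun x => A x + b) '' s =
      (A.toHomeomorph.trans (Homeomorph.addRight b)) '' s := rfl
  have hmaps : ∀ x ∈ D, A x + b ∈ D := fun x hx => hTD ▸ Set.mem_image_of_mem _ hx
  rw [himage] at hTD
  have hclosure : ∀ x ∈ closure D, A x + b ∈ closure D := fun x hx => by
    rw [← hTD, ← Homeomorph.image_closure]
    exact Set.mem_image_of_mem _ hx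
  have hfrontier : ∀ x ∈ frontier D, A x + b ∈ frontier D := fun x hx => by
    rw [← hTD, ← Homeomorph.image_frontier]
    exact Set.mem_image_of_mem _ hx
  have hsol' := hsol.comp_isometry A b hmaps
  have hcont' : ContinuousOn (fun y => u (A y + b)) (closure D) :=
    hcont.comp (by fun_prop) hclosure
  have heq : ∀ x ∈ frontier D, u (A x + b) = u x := fun x hx => by
    rw [hzero x hx, hzero _ (hfrontier x hx)]
  intro x hx
  exact le_antisymm
    (hsol'.le_of_le_frontier hDopen hDbdd hsol hcont' hcont (fun y hy => (heq y hy).le) hx)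
    (hsol.le_of_le_frontier hDopen hDbdd hsol' hcont hcont' (fun y hy => (heq y hy).ge) hx)
end
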